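/- arXiv:2511.10327 — 4 statements merged into one kernel-verified Lean document; each statement's English description precedes it below -/
import Mathlib

section
/- There exist homogeneous polynomials F and G of degree 4 in ℂ[x,y,z], linearly independent over ℂ, with the following properties: (1) there is a nonzero vector v ∈ ℂ³ such that for every nonzero w ∈ ℂ³ one has F(w) = 0 and G(w) = 0 if and only if w is a scalar multiple of v (the pencil of plane quartics spanned by F and G has base locus set-theoretically equal to a single point of ℙ²(ℂ)); (2) for every (λ, μ) ∈ ℂ² with (λ, μ) ≠ (0, 0), the polynomial λF + μG is irreducible in ℂ[x,y,z] (every member of the pencil is an irreducible quartic); (3) the set of points (λ : μ) of the projectivization of ℂ² for which there exists a nonzero w ∈ ℂ³ at which λF + μG and all three of its partial derivatives vanish is finite (the general member of the pencil is a smooth quartic); (4) there exist (λ₀, μ₀) ≠ (0, 0) and a nonzero w₀ ∈ ℂ³ at which λ₀F + μ₀G and all three of its partial derivatives vanish (the pencil has a singular, necessarily irreducible, member). -/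
open MvPolynomial

/-- The member `λF + μG` of the pencil spanned by `F, G ∈ ℂ[x, y, z]` is singular: there
is a nonzero point of `ℂ³` at which the polynomial and all three of its partial
derivatives vanish. -/
def IsSingularMember (F G : MvPolynomial (Fin 3) ℂ) (l m : ℂ) : Prop :=
  ∃ w : Fin 3 → ℂ, w ≠ 0 ∧ eval w (l • F + m • G) = 0 ∧
    ∀ i : Fin 3, eval w (pderiv i (l • F + m • G)) = 0

/-! ### Factors of homogeneous polynomials -/

section Homogeneous

variable {σ R : Type*} [CommRing R]

/-- The substitution `X i ↦ X i * T`, recording the homogeneous components of a polynomial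
as the coefficients of the powers of `T`. -/
noncomputable def MvPolynomial.homogenizingHom :
    MvPolynomial σ R →ₐ[R] Polynomial (MvPolynomial σ R) :=
  aeval fun i => Polynomial.C (X i) * Polynomial.X

theorem MvPolynomial.homogenizingHom_monomial (d : σ →₀ ℕ) (c : R) :
    homogenizingHom (monomial d c) = Polynomial.monomial d.degree (monomial d c) := by
  rw [homogenizingHom, aeval_monomial, monomial_eq (s := d), ← Polynomial.C_mul_X_pow_eq_monomial]
  simp only [Finsupp.prod, mul_pow, Finset.prod_mul_distrib, Finset.prod_pow_eq_pow_sum,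
    Finsupp.degree, map_mul, map_prod, map_pow, mul_assoc]
  rfl

theorem MvPolynomial.coeff_homogenizingHom (p : MvPolynomial σ R) (n : ℕ) (d : σ →₀ ℕ) :
    coeff d ((homogenizingHom p).coeff n) = if d.degree = n then coeff d p else 0 := by
  classical
  induction p using MvPolynomial.induction_on' with
  | monomial e c =>
    rw [homogenizingHom_monomial, Polynomial.coeff_monomial]
    by_cases h : e = d
    · subst h
      split_ifs <;> simp
    · split_ifs <;> simp [coeff_monomial, h]
  | add p q hp hq =>
    rw [map_add, Polynomial.coeff_add, coeff_add, hp, hq]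
    split_ifs <;> simp

theorem MvPolynomial.IsHomogeneous.homogenizingHom_eq {p : MvPolynomial σ R} {n : ℕ}
    (hp : p.IsHomogeneous n) : homogenizingHom p = Polynomial.monomial n p := by
  ext k d
  rw [coeff_homogenizingHom, Polynomial.coeff_monomial]
  by_cases hd : coeff d p = 0
  · split_ifs <;> simp [hd]
  · have : d.degree = n := by
      by_contra h
      exact hd (hp.coeff_eq_zero h)
    subst this
    split_ifs <;> simp

theorem MvPolynomial.exists_isHomogeneous_of_mul [IsDomain R] {p q : MvPolynomial σ R} {n : ℕ}
    (h : (p * q).IsHomogeneous n) (h0 : p * q ≠ 0) :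
    ∃ a b, p.IsHomogeneous a ∧ q.IsHomogeneous b ∧ a + b = n := by
  have hmul : homogenizingHom p * homogenizingHom q = Polynomial.monomial n (p * q) := by
    rw [← map_mul, h.homogenizingHom_eq]
  have hne : homogenizingHom p * homogenizingHom q ≠ 0 := by
    rw [hmul]
    simpa using h0
  have hp := left_ne_zero_of_mul hne
  have hq := right_ne_zero_of_mul hne
  have hdeg := Polynomial.natDegree_mul hp hq
  have htr := Polynomial.natTrailingDegree_mul hp hq
  rw [hmul, Polynomial.natDegree_monomial_eq _ h0] at hdeg
  rw [hmul, Polynomial.natTrailingDegree_monomial h0] at htr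
  have h1 := Polynomial.natTrailingDegree_le_natDegree (homogenizingHom p)
  have h2 := Polynomial.natTrailingDegree_le_natDegree (homogenizingHom q)
  have key : ∀ r : MvPolynomial σ R,
      (homogenizingHom r).natDegree ≤ (homogenizingHom r).natTrailingDegree →
      r.IsHomogeneous (homogenizingHom r).natDegree := by
    intro r hr
    have hcoeff : ∀ d, coeff d r ≠ 0 → d.degree = (homogenizingHom r).natDegree := by
      intro d hd
      have hd' : (homogenizingHom r).coeff d.degree ≠ 0 := by
        intro h0
        have := coeff_homogenizingHom r d.degree d
        rw [h0, if_pos rfl, coeff_zero] at this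
        exact hd this.symm
      exact le_antisymm (Polynomial.le_natDegree_of_ne_zero hd')
        (hr.trans (Polynomial.natTrailingDegree_le_of_ne_zero hd'))
    intro d hd
    rw [← hcoeff d hd, Finsupp.degree_eq_weight_one]
    rfl
  exact ⟨_, _, key p (by omega), key q (by omega), hdeg.symm⟩

theorem MvPolynomial.IsHomogeneous.eval_smul {p : MvPolynomial σ R} {n : ℕ}
    (hp : p.IsHomogeneous n) (c : R) (w : σ → R) : eval (c • w) p = c ^ n * eval w p := by
  rw [eval_eq, eval_eq, Finset.mul_sum]
  refine Finset.sum_congr rfl fun d hd => ?_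
  rw [hp.degree_eq_sum_deg_support hd]
  simp only [Pi.smul_apply, smul_eq_mul, mul_pow, Finset.prod_mul_distrib,
    Finset.prod_pow_eq_pow_sum]
  ring

end Homogeneous

/-! ### The pencil

In what follows `s` is a square root of `2`. -/

theorem two_add_ne_zero {s : ℂ} (hs : s ^ 2 = 2) : 2 + s ≠ 0 := by
  intro h
  have : (2 : ℂ) = 0 := by linear_combination (2 - s) * h + hs
  norm_num at this

/-- A rational quartic with three nodes. -/
noncomputable def trinodalQuartic (s : ℂ) : MvPolynomial (Fin 3) ℂ :=
  X 0 ^ 2 * X 1 ^ 2 + C (4 + s) * (X 0 * X 1 * X 2 ^ 2) - C 2 * (X 1 ^ 3 * X 2)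
    - C (1 + s) * (X 0 ^ 3 * X 2) - C (1 + s) * X 2 ^ 4

/-- A quartic meeting `trinodalQuartic s` in the single point `(1 : 0 : 0)`. -/
noncomputable def osculatingQuartic (s : ℂ) : MvPolynomial (Fin 3) ℂ :=
  X 1 ^ 4 - C (2 * s) * (X 0 * X 1 ^ 2 * X 2) + X 0 ^ 2 * X 2 ^ 2
    + C (4 - 2 * s) * (X 1 * X 2 ^ 3)

theorem isHomogeneous_trinodalQuartic (s : ℂ) : (trinodalQuartic s).IsHomogeneous 4 := by
  have hX := isHomogeneous_X ℂ (σ := Fin 3)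
  have h := isHomogeneous_X_pow (R := ℂ) (σ := Fin 3)
  exact (((((h 0 2).mul (h 1 2)).add ((((hX 0).mul (hX 1)).mul (h 2 2)).C_mul _)).sub
    (((h 1 3).mul (hX 2)).C_mul _)).sub (((h 0 3).mul (hX 2)).C_mul _)).sub ((h 2 4).C_mul _)

theorem isHomogeneous_osculatingQuartic (s : ℂ) : (osculatingQuartic s).IsHomogeneous 4 := by
  have hX := isHomogeneous_X ℂ (σ := Fin 3)
  have h := isHomogeneous_X_pow (R := ℂ) (σ := Fin 3)
  exact (((h 1 4).sub ((((hX 0).mul (h 1 2)).mul (hX 2)).C_mul _)).add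
    ((h 0 2).mul (h 2 2))).add (((hX 1).mul (h 2 3)).C_mul _)

theorem eval_trinodalQuartic (s : ℂ) (w : Fin 3 → ℂ) :
    eval w (trinodalQuartic s) = w 0 ^ 2 * w 1 ^ 2 + (4 + s) * (w 0 * w 1 * w 2 ^ 2)
      - 2 * (w 1 ^ 3 * w 2) - (1 + s) * (w 0 ^ 3 * w 2) - (1 + s) * w 2 ^ 4 := by
  simp [trinodalQuartic]

theorem eval_osculatingQuartic (s : ℂ) (w : Fin 3 → ℂ) :
    eval w (osculatingQuartic s) = w 1 ^ 4 - 2 * s * (w 0 * w 1 ^ 2 * w 2)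
      + w 0 ^ 2 * w 2 ^ 2 + (4 - 2 * s) * (w 1 * w 2 ^ 3) := by
  simp [osculatingQuartic]

theorem linearIndependent_quartics {s : ℂ} (hs : s ^ 2 = 2) :
    LinearIndependent ℂ ![trinodalQuartic s, osculatingQuartic s] := by
  rw [LinearIndependent.pair_iff]
  intro a b h
  have h1 := congrArg (eval ![0, 0, 1]) h
  have h2 := congrArg (eval ![0, 1, 0]) h
  simp [smul_eval, eval_trinodalQuartic, eval_osculatingQuartic] at h1 h2
  refine ⟨h1.resolve_right fun h3 => ?_, h2⟩
  have : (1 : ℂ) = 0 := by linear_combination -hs - (s - 1) * h3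
  exact one_ne_zero this

/-! ### The base locus -/

/-- The two generators of the pencil have no common zero in the chart `z = 1`. -/
theorem affine_quartics_disjoint {s x y : ℂ} (hs : s ^ 2 - 2 = 0)
    (hf : x ^ 2 * y ^ 2 + (4 + s) * x * y - 2 * y ^ 3 - (1 + s) * x ^ 3 - (1 + s) = 0)
    (hg : y ^ 4 - 2 * s * x * y ^ 2 + x ^ 2 + (4 - 2 * s) * y = 0) : False := by
  refine one_ne_zero (α := ℂ) ?_
  have e1 : (-1 - s)*x^2*y + x*y^3 + (1 + 1/2*s)*x + (2 - 3/2*s)*y^2 = 0 := by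
    linear_combination ((-1/2*s)*x + (1 + 1/2*s)*y^2)*hf + ((-1 - 1/2*s)*x^2 + (2 + s)*y)*hg +
      ((-1/2)*x^4 + (-1/2)*x^3*y^2 + (-1/2)*x^2*y + (3/2)*x*y^3 + (-1/2)*x + (5/2)*y^2)*hs
  linear_combination ((10 + 7*s)*x*y + (1 - s))*hf + ((-10 - 7*s)*x^2 + (4 + 2*s)*y)*e1 + ((16 +
    12*s)*x)*hg + ((5/2)*x^3 + (17/2)*x^2*y^2 + 31*x*y + 3*y^3 + (-1))*hs

theorem base_locus {s : ℂ} (hs : s ^ 2 = 2) (w : Fin 3 → ℂ) :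
    (eval w (trinodalQuartic s) = 0 ∧ eval w (osculatingQuartic s) = 0) ↔
      ∃ c : ℂ, w = c • ![1, 0, 0] := by
  rw [eval_trinodalQuartic, eval_osculatingQuartic]
  constructor
  · rintro ⟨hf, hg⟩
    have hz : w 2 = 0 := by
      by_contra hz
      refine affine_quartics_disjoint (s := s) (x := w 0 / w 2) (y := w 1 / w 2)
        (by rw [hs, sub_self]) ?_ ?_
      · field_simp
        linear_combination hf
      · field_simp
        linear_combination hg
    have hy : w 1 = 0 := by simpa [hz] using hg
    refine ⟨w 0, ?_⟩
    ext i
    fin_cases i <;> simp [hy, hz]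
  · rintro ⟨c, rfl⟩
    simp

/-! ### Irreducibility of the members -/

/-- The normalization of `trinodalQuartic s`, on which `osculatingQuartic s` is constant. -/
noncomputable def nodalParam (s : ℂ) : Fin 3 → Polynomial ℂ :=
  ![Polynomial.C (s - 1) * (Polynomial.X ^ 4 + Polynomial.C (2 + s) * Polynomial.X),
    Polynomial.X ^ 3 + 1, Polynomial.X ^ 2]

theorem eval_aeval_nodalParam (s t : ℂ) (p : MvPolynomial (Fin 3) ℂ) :
    (aeval (nodalParam s) p).eval t =
      eval ![(s - 1) * (t ^ 4 + (2 + s) * t), t ^ 3 + 1, t ^ 2] p := by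
  induction p using MvPolynomial.induction_on with
  | C a => simp [Polynomial.algebraMap_eq]
  | add p q hp hq => simp [hp, hq]
  | mul_X p i hp =>
    rw [map_mul, Polynomial.eval_mul, hp, map_mul]
    fin_cases i <;> simp [nodalParam]

theorem aeval_nodalParam_member {s : ℂ} (hs : s ^ 2 = 2) (l m : ℂ) :
    aeval (nodalParam s) (l • trinodalQuartic s + m • osculatingQuartic s) = Polynomial.C m := by
  refine Polynomial.funext fun t => ?_
  rw [eval_aeval_nodalParam, map_add, smul_eval, smul_eval, eval_trinodalQuartic,
    eval_osculatingQuartic, Polynomial.eval_C]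
  simp only [Matrix.cons_val_zero, Matrix.cons_val_one, Matrix.cons_val]
  grind

/-- Two parameters of a node of `trinodalQuartic s`, at which the values of `nodalParam s`
differ by a primitive fourth root of unity. -/
theorem exists_node_params {s : ℂ} (hs : s ^ 2 = 2) :
    ∃ a b ζ : ℂ, ζ ^ 2 = -1 ∧
      (![(s - 1) * (b ^ 4 + (2 + s) * b), b ^ 3 + 1, b ^ 2] : Fin 3 → ℂ) =
        ζ • ![(s - 1) * (a ^ 4 + (2 + s) * a), a ^ 3 + 1, a ^ 2] := by
  obtain ⟨r, hr⟩ := IsAlgClosed.exists_pow_nat_eq (-2 : ℂ) (n := 2) (by norm_num)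
  obtain ⟨η, hη⟩ : ∃ η : ℂ, η ^ 2 = s * η - 1 :=
    ⟨(s + r) / 2, by linear_combination hr / 4 - hs / 4⟩
  have hη4 : η ^ 4 = -1 := by
    linear_combination (η ^ 2 + s * η + 1) * hη + η ^ 2 * hs
  have hη0 : η ≠ 0 := by
    rintro rfl
    norm_num at hη4
  obtain ⟨a, ha⟩ := IsAlgClosed.exists_pow_nat_eq ((η + 1) / η ^ 2) (n := 3) (by norm_num)
  have ha' : a ^ 3 * η ^ 2 = η + 1 := by
    rw [ha]
    field_simp
  refine ⟨a, η * a, η ^ 2, by linear_combination hη4, ?_⟩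
  ext i
  fin_cases i
  · simp
    grind
  · simp
    linear_combination (η - 1) * ha'
  · simp
    ring

theorem aeval_nodalParam_ne_C {s c : ℂ} (hs : s ^ 2 = 2) (hc : c ≠ 0)
    {p : MvPolynomial (Fin 3) ℂ} {n : ℕ} (hp : p.IsHomogeneous n) (h0 : n ≠ 0) (h4 : n < 4) :
    aeval (nodalParam s) p ≠ Polynomial.C c := by
  intro h
  obtain ⟨a, b, ζ, hζ, hab⟩ := exists_node_params hs
  have h1 := eval_aeval_nodalParam s a p
  have h2 := eval_aeval_nodalParam s b p
  rw [hab, hp.eval_smul, ← h1, h, Polynomial.eval_C, Polynomial.eval_C] at h2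
  have h3 : ζ ^ n = 1 := mul_right_cancel₀ hc (by rw [← h2, one_mul])
  have hζ1 : ζ ≠ 1 := by
    rintro rfl
    norm_num at hζ
  interval_cases n
  · exact h0 rfl
  · exact hζ1 (by simpa using h3)
  · rw [hζ] at h3
    norm_num at h3
  · have : ζ = -1 := by linear_combination ζ * hζ - h3
    rw [this] at hζ
    norm_num at hζ

/-- A ternary form of degree `3`, written out. -/
theorem MvPolynomial.IsHomogeneous.exists_cubic_coeffs {R : Type*} [CommRing R]
    {p : MvPolynomial (Fin 3) R} (hp : p.IsHomogeneous 3) :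
    ∃ c : ℕ → ℕ → R, p = ∑ i ∈ Finset.range 4, ∑ j ∈ Finset.range (4 - i),
      C (c i j) * (X 0 ^ i * X 1 ^ j * X 2 ^ (3 - i - j)) := by
  let e : ℕ → ℕ → Fin 3 →₀ ℕ := fun i j => Finsupp.equivFunOnFinite.symm ![i, j, 3 - i - j]
  have he : ∀ i j, C (coeff (e i j) p) * (X 0 ^ i * X 1 ^ j * X 2 ^ (3 - i - j)) =
      monomial (e i j) (coeff (e i j) p) := by
    intro i j
    rw [monomial_eq, Finsupp.prod_fintype _ _ (by simp), Fin.prod_univ_three]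
    simp [e]
  refine ⟨fun i j => coeff (e i j) p, ?_⟩
  ext d
  simp only [he, coeff_sum, coeff_monomial]
  by_cases hd : d.degree = 3
  · have h3 : d 0 + d 1 + d 2 = 3 := by
      rwa [Finsupp.degree_eq_sum, Fin.sum_univ_three] at hd
    have hed : e (d 0) (d 1) = d := by
      ext i
      fin_cases i <;> simp [e]
      omega
    rw [Finset.sum_eq_single (d 0), Finset.sum_eq_single (d 1), if_pos hed, hed]
    · exact fun j _ hj => if_neg fun h => hj (congrArg (fun f => f 1) h)
    · exact fun h => (h (Finset.mem_range.mpr (by omega))).elim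
    · exact fun i _ hi => Finset.sum_eq_zero fun j _ => if_neg fun h => hi (congrArg (fun f => f 0) h)
    · exact fun h => (h (Finset.mem_range.mpr (by omega))).elim
  · rw [hp.coeff_eq_zero hd]
    refine (Finset.sum_eq_zero fun i hi => Finset.sum_eq_zero fun j hj => if_neg ?_).symm
    rintro rfl
    rw [Finset.mem_range] at hi hj
    refine hd ?_
    rw [Finsupp.degree_eq_sum, Fin.sum_univ_three]
    simp [e]
    omega

theorem eq_zero_of_aeval_nodalParam {s : ℂ} (hs : s ^ 2 = 2) {p : MvPolynomial (Fin 3) ℂ}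
    (hp : p.IsHomogeneous 3) (h : aeval (nodalParam s) p = 0) : p = 0 := by
  obtain ⟨c, rfl⟩ := hp.exists_cubic_coeffs
  have hq : s - 1 ≠ 0 := fun h => by
    have : (1 : ℂ) = 0 := by linear_combination (s + 1) * h - hs
    exact one_ne_zero this
  have hk : 2 + s ≠ 0 := two_add_ne_zero hs
  have hparam : nodalParam s = ![.C (s - 1) * (.X ^ 4 + .C (2 + s) * .X), .X ^ 3 + 1, .X ^ 2] := rfl
  generalize s - 1 = q, 2 + s = k at hq hk hparam
  rw [hparam] at h
  simp only [Finset.sum_range_succ, Finset.sum_range_zero, map_zero, map_add, map_mul,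
    map_pow, aeval_C, aeval_X, Polynomial.algebraMap_eq, Matrix.cons_val_zero, Matrix.cons_val_one,
    Matrix.cons_val] at h
  have hcoeff : Polynomial.C (q ^ 3 * c 3 0) * Polynomial.X ^ 12
      + Polynomial.C (q ^ 2 * c 2 1) * Polynomial.X ^ 11
      + Polynomial.C (q ^ 2 * c 2 0 + q * c 1 2) * Polynomial.X ^ 10
      + Polynomial.C (3 * k * q ^ 3 * c 3 0 + q * c 1 1 + c 0 3) * Polynomial.X ^ 9
      + Polynomial.C ((1 + 2 * k) * q ^ 2 * c 2 1 + q * c 1 0 + c 0 2) * Polynomial.X ^ 8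
      + Polynomial.C (2 * k * q ^ 2 * c 2 0 + (2 + k) * q * c 1 2 + c 0 1) * Polynomial.X ^ 7
      + Polynomial.C (3 * k ^ 2 * q ^ 3 * c 3 0 + (1 + k) * q * c 1 1 + 3 * c 0 3 + c 0 0)
        * Polynomial.X ^ 6
      + Polynomial.C ((2 * k + k ^ 2) * q ^ 2 * c 2 1 + k * q * c 1 0 + 2 * c 0 2)
        * Polynomial.X ^ 5
      + Polynomial.C (k ^ 2 * q ^ 2 * c 2 0 + (1 + 2 * k) * q * c 1 2 + c 0 1) * Polynomial.X ^ 4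
      + Polynomial.C (k ^ 3 * q ^ 3 * c 3 0 + k * q * c 1 1 + 3 * c 0 3) * Polynomial.X ^ 3
      + Polynomial.C (k ^ 2 * q ^ 2 * c 2 1 + c 0 2) * Polynomial.X ^ 2
      + Polynomial.C (k * q * c 1 2) * Polynomial.X ^ 1
      + Polynomial.C (c 0 3) * Polynomial.X ^ 0 = 0 := by
    rw [← h]
    simp only [map_add, map_mul, map_pow, map_ofNat, map_one]
    ring
  have key : ∀ n, _ := fun n => congrArg (fun f => f.coeff n) hcoeff
  simp only [Polynomial.coeff_add, Polynomial.coeff_C_mul, Polynomial.coeff_X_pow,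
    Polynomial.coeff_zero] at key
  have h30 : c 3 0 = 0 := by simpa [hq] using key 12
  have h21 : c 2 1 = 0 := by simpa [hq] using key 11
  have h12 : c 1 2 = 0 := by simpa [hq, hk] using key 1
  have h03 : c 0 3 = 0 := by simpa using key 0
  have h20 : c 2 0 = 0 := by simpa [hq, h12] using key 10
  have h11 : c 1 1 = 0 := by simpa [hq, h30, h03] using key 9
  have h02 : c 0 2 = 0 := by simpa [h21] using key 2
  have h10 : c 1 0 = 0 := by simpa [hq, h21, h02] using key 8
  have h01 : c 0 1 = 0 := by simpa [h20, h12] using key 7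
  have h00 : c 0 0 = 0 := by simpa [h30, h11, h03] using key 6
  simp [Finset.sum_range_succ, h30, h21, h12, h03, h20, h11, h02, h10, h01, h00]

theorem aeval_nodalParam_ne_zero {s : ℂ} (hs : s ^ 2 = 2) {p : MvPolynomial (Fin 3) ℂ} {n : ℕ}
    (hp : p.IsHomogeneous n) (hn : n < 4) (h0 : p ≠ 0) : aeval (nodalParam s) p ≠ 0 := by
  intro h
  have hhom : (p * X 2 ^ (3 - n)).IsHomogeneous 3 := by
    have := hp.mul (isHomogeneous_X_pow (R := ℂ) (2 : Fin 3) (3 - n))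
    rwa [show n + (3 - n) = 3 by omega] at this
  exact mul_ne_zero h0 (pow_ne_zero _ (X_ne_zero _))
    (eq_zero_of_aeval_nodalParam hs hhom (by rw [map_mul, h, zero_mul]))

theorem irreducible_member {s : ℂ} (hs : s ^ 2 = 2) {l m : ℂ} (hlm : (l, m) ≠ (0, 0)) :
    Irreducible (l • trinodalQuartic s + m • osculatingQuartic s) := by
  have hhom : (l • trinodalQuartic s + m • osculatingQuartic s).IsHomogeneous 4 := by
    simp only [smul_eq_C_mul]
    exact ((isHomogeneous_trinodalQuartic s).C_mul l).add
      ((isHomogeneous_osculatingQuartic s).C_mul m)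
  have hne : l • trinodalQuartic s + m • osculatingQuartic s ≠ 0 := by
    intro h
    have := LinearIndependent.pair_iff.mp (linearIndependent_quartics hs) l m h
    exact hlm (Prod.ext this.1 this.2)
  have hparam := aeval_nodalParam_member hs l m
  have hunit : ∀ q : MvPolynomial (Fin 3) ℂ, q ≠ 0 → q.IsHomogeneous 0 → IsUnit q := by
    intro q hq0 hq
    have e := totalDegree_eq_zero_iff_eq_C.mp (hq.totalDegree hq0)
    have hc : coeff 0 q ≠ 0 := fun h => hq0 (by rw [e, h, C_0])
    rw [e]
    exact (isUnit_iff_ne_zero.mpr hc).map C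
  refine ⟨fun h => ?_, fun p q hpq => ?_⟩
  · have := (isUnit_iff_totalDegree_of_isReduced.mp h).2
    rw [hhom.totalDegree hne] at this
    norm_num at this
  rw [hpq] at hhom hne hparam
  obtain ⟨a, b, ha, hb, hab⟩ := exists_isHomogeneous_of_mul hhom hne
  have hp0 := left_ne_zero_of_mul hne
  have hq0 := right_ne_zero_of_mul hne
  by_contra! hnu
  have ha0 : a ≠ 0 := by
    rintro rfl
    exact hnu.1 (hunit p hp0 ha)
  have hb0 : b ≠ 0 := by
    rintro rfl
    exact hnu.2 (hunit q hq0 hb)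
  rw [map_mul] at hparam
  by_cases hm : m = 0
  · rw [hm, Polynomial.C_0] at hparam
    exact mul_ne_zero (aeval_nodalParam_ne_zero hs ha (by omega) hp0)
      (aeval_nodalParam_ne_zero hs hb (by omega) hq0) hparam
  · have hu : IsUnit (aeval (nodalParam s) p) := by
      refine isUnit_of_mul_isUnit_left (y := aeval (nodalParam s) q) ?_
      rw [hparam]
      exact Polynomial.isUnit_C.mpr (isUnit_iff_ne_zero.mpr hm)
    obtain ⟨c, hc, hpc⟩ := Polynomial.isUnit_iff.mp hu
    exact aeval_nodalParam_ne_C hs hc.ne_zero ha ha0 (by omega) hpc.symm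

/-! ### The singular members -/

theorem eval_pderiv_member (s l m : ℂ) (w : Fin 3 → ℂ) :
    eval w (pderiv 0 (l • trinodalQuartic s + m • osculatingQuartic s)) =
      l * (2 * w 0 * w 1 ^ 2 + (4 + s) * (w 1 * w 2 ^ 2) - 3 * (1 + s) * (w 0 ^ 2 * w 2))
        + m * (-2 * s * (w 1 ^ 2 * w 2) + 2 * w 0 * w 2 ^ 2) ∧
    eval w (pderiv 1 (l • trinodalQuartic s + m • osculatingQuartic s)) =
      l * (2 * w 0 ^ 2 * w 1 + (4 + s) * (w 0 * w 2 ^ 2) - 6 * (w 1 ^ 2 * w 2))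
        + m * (4 * w 1 ^ 3 - 4 * s * (w 0 * w 1 * w 2) + (4 - 2 * s) * w 2 ^ 3) ∧
    eval w (pderiv 2 (l • trinodalQuartic s + m • osculatingQuartic s)) =
      l * (2 * (4 + s) * (w 0 * w 1 * w 2) - 2 * w 1 ^ 3 - (1 + s) * w 0 ^ 3
        - 4 * (1 + s) * w 2 ^ 3)
        + m * (-2 * s * (w 0 * w 1 ^ 2) + 2 * w 0 ^ 2 * w 2 + 3 * (4 - 2 * s) * (w 1 * w 2 ^ 2)) := by
  refine ⟨?_, ?_, ?_⟩ <;>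
  · simp [trinodalQuartic, osculatingQuartic, pderiv_X, smul_eval]
    ring

/-- An elimination of the affine coordinates `x`, `y` of a singular point. -/
theorem affine_discriminant {s x y m : ℂ} (hs : s ^ 2 - 2 = 0)
    (hx : 2 * x * y ^ 2 + (4 + s) * y - 3 * (1 + s) * x ^ 2 + m * (-2 * s * y ^ 2 + 2 * x) = 0)
    (hy : 2 * x ^ 2 * y + (4 + s) * x - 6 * y ^ 2
      + m * (4 * y ^ 3 - 4 * s * x * y + (4 - 2 * s)) = 0)
    (hz : 2 * (4 + s) * x * y - 2 * y ^ 3 - (1 + s) * x ^ 3 - 4 * (1 + s)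
      + m * (-2 * s * x * y ^ 2 + 2 * x ^ 2 + 3 * (4 - 2 * s) * y) = 0) :
    m ^ 7 + (-1799 / 108 + 1787 / 108 * s) * m ^ 4 - (27 - 27 * s) * m = 0 := by
  have e1 : (-3/2 - s)*x^2*y + x*y^3 + (-1)*x*y*m + (1/2 + s)*x + (2 - s)*y^2 + (-1 + s)*m = 0 := by
    linear_combination ((1/4*s))*hy + ((1/2)*y)*hx + (x*y*m + (-1/4)*x + (1/2)*m)*hs
  have e2 : (-1 - s)*x^3 + x^2*y^2 + (-2 - 1/2*s)*x*y + y^3 + (-6 + 3*s)*y*m + (2 + 2*s) = 0 := by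
    linear_combination ((-1/2))*hz + ((1/2)*x)*hx
  have e3 : (1/2)*x^3*y + x^2*y*m + (4 - s)*x^2 + (-1 - 5/2*s)*x*y^2 + (4 - 4*s)*x*m + y^4 + (5 -
      5/2*s)*y = 0 := by
    linear_combination ((-1/2)*y)*hz + ((-1/4*s)*x)*hy + ((3/2 - 3/2*s))*hx + ((-1)*x^2*y*m +
      (-17/4)*x^2 + (-1/2)*x*m + (-3)*y^2*m + (3/2)*y)*hs
  have e4 : (1/2)*x^4 + x^3*m + (7/2 - 3*s)*x^2*y + (16 - 11*s)*x*y*m + 2*x + (1 - 3/2*s)*y^2 + (18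
      - 12*s)*y*m^2 + (-2*s)*m = 0 := by
    linear_combination ((1/2 - 1/2*s)*x)*hz + ((-2 + s)*m)*e2 + ((1/2 - 1/2*s)*y)*hx + ((-1/2)*x^4 +
      x^3*m + (-1)*x^2*y^2*m + (-1/2)*x^2*y + (-5/2)*x*y*m + (-2)*x + (-1)*y^3*m + (1/2)*y^2 +
      (-3)*y*m^2 + (-2)*m)*hs
  have e5 : (-1/4)*x^3*y + (-7/2 + 7/4*s)*x^2 + (1 + 11/4*s)*x*y^2 + x*y*m^2 + (-9/2 + 7/2*s)*x*m +
      (-3/2)*y^4 + (-13/2 + 9/4*s)*y + (1 - s)*m^2 = 0 := by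
    linear_combination ((1/4)*x)*hy + ((3/2)*x + (-1)*m)*e1 + ((-3/2)*y)*e2 + ((-7/4 + 7/4*s))*hx +
      ((21/4)*x^2 + (7/2)*y^2*m + (-7/4)*y)*hs
  have e7 : (-1/4 - 5/12*s)*x^3 + (-5/6*s)*x^2*m + (4 + 5/2*s)*x*y + x*m^2 + (-7/6 - 2/3*s)*y^3 +
      (4/3 + 1/3*s)*y*m + (-10/3 - 7/3*s) = 0 := by
    linear_combination ((2/3 + 1/2*s)*y)*e4 + ((-2/3 - 1/2*s)*x)*e3 + ((2/3 + 1/2*s)*y)*e1 +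
      ((1/12)*x + (1/2)*m)*hx + ((-2/3 - 1/2*s))*e2 + ((-1)*x^3 + (3/4)*x^2*y^2 + (-2)*x^2*m +
      (11/2)*x*y^2*m + (-2)*x*y + (5/4)*y^3 + 6*y^2*m^2 + 2*y*m + 1)*hs
  have e8 : (1/4 - 1/12*s)*x^2*y + (1 - 1/6*s)*x*y*m + (5/12 + 5/24*s)*x + (-1/4 - 1/4*s)*y^2 +
      y*m^2 + (-1 - 11/12*s)*m = 0 := by
    linear_combination ((-2 - 3/2*s)*y)*e5 + ((-37/24 - 13/12*s)*x + (-3/4 - 1/2*s)*m)*hz + ((1 +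
      3/4*s)*x + (-4/3 - 5/6*s)*m)*e2 + ((-3 - 9/4*s)*y)*e3 + ((3/2 + s)*x)*e7 + ((1/12 +
      1/24*s)*y)*hx + ((-31/6 - 43/12*s))*e1 + ((1/12)*x^4 + (-1/2)*x^3*m + (-13/6)*x^2*y^2*m +
      (-73/24)*x^2*y + (-5/6)*x*y^3 + (-1)*x*y^2*m^2 + (-49/4)*x*y*m + (1/12)*x + (1/12)*y^3*m +
      (-47/8)*y^2 + (-2)*y*m^2 + (13/4)*m)*hs
  have e9 : (-9/2 + 5/2*s)*x^2 + (-5/2)*x*y^2 + (-14 + 17/2*s)*x*m + y^4 + (-9/2 + 11/2*s)*y + (-12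
      + 9*s)*m^2 = 0 := by
    linear_combination ((-3/2 + 3/4*s)*x)*hy + ((-4 - 1/2*s)*x + (6 - 3*s)*m)*e1 + ((6 - 3*s)*y)*e7
      + ((4 + 1/2*s)*y)*e2 + ((-5/2 + 3/4*s))*hx + ((-5/4)*x^3*y + (-5/2)*x^2*y*m + 2*x^2 +
      (29/4)*x*y^2 + 5*x*m + (-2)*y^4 + (-2)*y^2*m + (-35/4)*y + 3*m^2)*hs
  have e10 : (3/14 - 27/14*s)*x^2 + x*y^2 + (32/7 - 22/7*s)*x*m + (20/7 - 17/14*s)*y + (30/7 -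
      18/7*s)*m^2 = 0 := by
    linear_combination ((36/7 + 26/7*s)*y)*e2 + ((-36/7 - 26/7*s)*x)*e1 + ((12/7 + 18/7*s)*y)*e7 +
      ((-12/7 - 18/7*s)*x)*e8 + ((2/7 + 3/7*s))*e9 + ((-10/7 - 8/7*s))*hx + ((6/7)*x^3*y +
      (12/7)*x^2*y*m + (-1/4)*x^2 + (-125/14)*x*y^2 + (-16/7)*x*m + (12/7)*y^4 + (-100/7)*y^2*m +
      (-37/14)*y + (-27/7)*m^2)*hs
  have e11 : (1/2)*x^3 + x^2*m + (-2)*x*y + (-1 + s)*y^3 + (-2 + s)*y*m + s = 0 := by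
    linear_combination ((-2 - 3/2*s)*y)*e1 + ((2 + 3/2*s)*x)*e9 + ((-25/4 + 4*s)*x + (-12 +
      15/2*s)*m)*hx + ((30 - 24*s)*y)*e8 + ((21 - 15*s))*e7 + (2*x^3 + (-7/2)*x^2*y^2 +
      (-11/4)*x^2*m + 4*x*y^2*m + (127/4)*x*y + (-27/2)*x*m^2 + (-35/2)*y^3 + 15*y^2*m^2 + (-23)*y*m
      + (-35))*hs
  have e13 : (2/3)*x*y + y*m + (-2/3 - 2/3*s) = 0 := by
    linear_combination ((24 - 17*s))*e7 + ((36 - 26*s)*y)*e8 + ((-7 + 14/3*s)*x + (-13 + 9*s)*m)*hx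
      + ((2/3 + 1/6*s)*x)*e10 + ((-4/3))*e11 + ((152/21)*x^3 + (-13/6)*x^2*y^2 + (187/14)*x^2*m +
      5*x*y^2*m + (1825/42)*x*y + (3/7)*x*m^2 + (-107/6)*y^3 + 18*y^2*m^2 + (-163/6)*y*m +
      (-119/3))*hs
  have e14 : (-1)*x^2 + (-5/6 + 1/6*s)*x*m + s*y + m^2 = 0 := by
    linear_combination ((-3/4 + 1/4*s))*hx + ((1 - 3/2*s)*y)*e13 + ((5/6 + 1/2*s))*e10 + ((12/7)*x^2
      + (11/7)*x*m + (1/2)*y^2*m + (-9/14)*y + (9/7)*m^2)*hs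
  have e15 : x^2*y + (8 + 7/2*s)*x + (-9)*y^2 + (-6 - 3*s)*m = 0 := by
    linear_combination ((-36 + 36*s))*e8 + ((24 - 18*s)*x + (36 - 36*s)*m)*e13 + (3*x^2*y + 6*x*y*m
      + (-39/2)*x + 9*y^2 + 9*m)*hs
  have e16 : x^3 + (6 + 2*s)*x*y + (10 - 10*s)*y^3 + (-2 - 4*s) = 0 := by
    linear_combination ((1/6 - 1/6*s)*x)*hx + ((7/9 - 7/9*s)*x + (-2/3 + 1/3*s)*m)*e10 + ((8/3 -
      5/3*s)*x + (32/7 - 22/7*s)*m)*e14 + ((-10/9 + 10/9*s)*y)*e15 + ((9 - 3*s))*e13 + ((-2)*x^3 +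
      (-32/21)*x^2*m + (-1/3)*x*y^2*m + (-3)*x*y + (-3/7)*x*m^2 + (289/42)*y*m + (6/7)*m^3 +
      (-2))*hs
  have e17 : m^4 = (7/3 + 137/18*s)*x + (95/9 - 116/9*s)*y^2 + (-793/108 - 239/108*s)*m := by
    linear_combination ((5/6 - 1/6*s)*x*m + m^2)*e14 + ((-1/24 - 1/36*s)*x + (7/4 - 5/18*s)*m)*e11 +
      ((277/36 - 269/72*s)*x + (83/36 - 73/36*s)*y^2 + (53/3 - 475/36*s)*m)*e13 + ((1/48 +
      1/72*s)*x)*e16 + ((-157/108 + 155/108*s)*y)*e10 + ((49/108 - 173/216*s))*e15 +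
      ((1381/504)*x^2*y + (1/36)*x^2*m^2 + (1/6)*x*y^3 + (3557/756)*x*y*m + (19/48)*x + (5/18)*y^3*m
      + (197/504)*y^2 + (250/63)*y*m^2 + (-2359/216)*m)*hs
  have e18 : m^7 = (-51760/243 + 171409/1944*s)*x + (195163/324 - 378449/972*s)*y^2 + (-85831/3888 +
      336101/5832*s)*m := by
    linear_combination m^3*e17 + ((2207725/4536 - 18916463/54432*s)*x + (2575835/3888 -
      12661/27*s)*y^2 + (95/9 - 116/9*s)*y*m^2 + (24907373/13608 - 35080343/27216*s)*m)*e13 +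
      ((-1143565/11664 + 20615/324*s)*y + (-190/27 + 232/27*s)*m^2)*e10 + ((105881/648 -
      12157/108*s)*x*m + (50657/756 - 43193/756*s)*m^2)*e14 + ((200039/7776 - 122653/7776*s)*x +
      (1070533/3888 - 752651/3888*s)*m)*e11 + ((-200039/15552 + 122653/15552*s)*x)*e16 +
      ((531127/13608 - 3947495/163296*s))*e15 + ((831527/7776)*x^2*y + (160267/4536)*x^2*m^2 +
      (122653/1296)*x*y^3 + (2552917/7776)*x*y*m + (165689/4536)*x*m^3 + (-3619901/36288)*x +
      (752651/3888)*y^3*m + (-50837/216)*y^2 + (11326457/27216)*y*m^2 + (464/21)*m^4 +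
      (-120552515/163296)*m)*hs
  linear_combination ((-1799/108 + 1787/108*s))*e17 + e18 + ((244819/1944)*x + (-51823/243)*y^2 +
    (-427093/11664)*m)*hs

/-- The parameters of the singular members, apart from `osculatingQuartic s`, are roots of
this polynomial. -/
noncomputable def discriminantPoly (s : ℂ) : Polynomial ℂ :=
  Polynomial.X ^ 7 + Polynomial.C (-1799 / 108 + 1787 / 108 * s) * Polynomial.X ^ 4
    - Polynomial.C (27 - 27 * s) * Polynomial.X

theorem discriminantPoly_ne_zero (s : ℂ) : discriminantPoly s ≠ 0 := by
  intro h
  have := congrArg (fun p => p.coeff 7) h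
  simp only [discriminantPoly, Polynomial.coeff_sub, Polynomial.coeff_add, Polynomial.coeff_C_mul,
    Polynomial.coeff_X_pow, Polynomial.coeff_X, Polynomial.coeff_zero] at this
  norm_num at this

theorem isRoot_discriminantPoly {s l m : ℂ} (hs : s ^ 2 = 2) (hl : l ≠ 0)
    (h : IsSingularMember (trinodalQuartic s) (osculatingQuartic s) l m) :
    (discriminantPoly s).IsRoot (m / l) := by
  obtain ⟨w, hw, -, hd⟩ := h
  obtain ⟨ex, ey, ez⟩ := eval_pderiv_member s l m w
  rw [hd] at ex ey ez
  by_cases hz : w 2 = 0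
  · simp only [hz] at ex ey ez
    have hxy : w 0 * w 1 = 0 := by
      have : l * (w 0 * w 1) * w 1 = 0 := by linear_combination -ex / 2
      by_contra hne
      exact mul_ne_zero (mul_ne_zero hl hne) (right_ne_zero_of_mul hne) this
    have hs1 : 1 + s ≠ 0 := fun h => by
      have : (1 : ℂ) = 0 := by linear_combination (s - 1) * h - hs
      exact one_ne_zero this
    have hx : w 0 = 0 := by
      by_contra hx
      have hy := (mul_eq_zero.mp hxy).resolve_left hx
      rw [hy] at ez
      have : l * (1 + s) * w 0 ^ 3 = 0 := by linear_combination ez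
      exact mul_ne_zero (mul_ne_zero hl hs1) (pow_ne_zero 3 hx) this
    have hy : w 1 = 0 := by
      by_contra hy
      rw [hx] at ez
      have : l * w 1 ^ 3 = 0 := by linear_combination ez / 2
      exact mul_ne_zero hl (pow_ne_zero 3 hy) this
    refine (hw ?_).elim
    ext i
    fin_cases i <;> assumption
  · have key := affine_discriminant (s := s) (x := w 0 / w 2) (y := w 1 / w 2) (m := m / l)
      (by rw [hs, sub_self]) ?_ ?_ ?_
    · simpa [discriminantPoly] using key
    · field_simp
      linear_combination -ex
    · field_simp
      linear_combination -ey
    · field_simp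
      linear_combination -ez

theorem finite_singular_members {s : ℂ} (hs : s ^ 2 = 2) :
    {p : Projectivization ℂ (Fin 2 → ℂ) |
      IsSingularMember (trinodalQuartic s) (osculatingQuartic s) (p.rep 0) (p.rep 1)}.Finite := by
  have hv : ∀ t : ℂ, (![1, t] : Fin 2 → ℂ) ≠ 0 := fun t h => by simpa using congrFun h 0
  have hv' : (![0, 1] : Fin 2 → ℂ) ≠ 0 := fun h => by simpa using congrFun h 1
  refine (((discriminantPoly s).rootSet_finite ℂ).image
    (fun t => Projectivization.mk ℂ ![1, t] (hv t)) |>.insert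
    (Projectivization.mk ℂ ![0, 1] hv')).subset fun p hp => ?_
  by_cases hl : p.rep 0 = 0
  · left
    rw [← p.mk_rep, Projectivization.mk_eq_mk_iff']
    refine ⟨p.rep 1, ?_⟩
    ext i
    fin_cases i <;> simp [hl]
  · right
    refine ⟨p.rep 1 / p.rep 0, ?_, ?_⟩
    · rw [Polynomial.mem_rootSet]
      exact ⟨discriminantPoly_ne_zero s, by
        simpa [Polynomial.IsRoot] using isRoot_discriminantPoly hs hl hp⟩
    · conv_rhs => rw [← p.mk_rep]
      rw [Projectivization.mk_eq_mk_iff']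
      refine ⟨(p.rep 0)⁻¹, ?_⟩
      ext i
      fin_cases i
      · simp [hl]
      · simp [div_eq_inv_mul]

theorem isSingularMember_trinodalQuartic {s : ℂ} (hs : s ^ 2 = 2) :
    IsSingularMember (trinodalQuartic s) (osculatingQuartic s) 1 0 := by
  have hk := two_add_ne_zero hs
  obtain ⟨r, hr⟩ := IsAlgClosed.exists_pow_nat_eq (2 + s)⁻¹ (n := 3) (by norm_num)
  have hr' : r ^ 3 * (2 + s) = 1 := by rw [hr, inv_mul_cancel₀ hk]
  obtain ⟨ex, ey, ez⟩ := eval_pderiv_member s 1 0 ![(2 + s) * r ^ 2, (1 + s) * r, 1]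
  refine ⟨![(2 + s) * r ^ 2, (1 + s) * r, 1], fun h => by simpa using congrFun h 2, ?_, ?_⟩
  · rw [map_add, smul_eval, smul_eval, eval_trinodalQuartic]
    simp
    grind
  · intro i
    fin_cases i
    · refine ex.trans ?_
      simp
      grind
    · refine ey.trans ?_
      simp
      grind
    · refine ez.trans ?_
      simp
      grind

/-- Main theorem of the paper (Mathlib-expressible content): there exists a pencil of
plane quartics whose base locus is set-theoretically a single point, all of whose members
are irreducible, whose general member is smooth (only finitely many members of the pencil
are singular), and which contains a singular member (hence is non-isotrivial). -/
theorem exists_special_pencil_of_quartics :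
    ∃ F G : MvPolynomial (Fin 3) ℂ,
      F.IsHomogeneous 4 ∧ G.IsHomogeneous 4 ∧
      LinearIndependent ℂ ![F, G] ∧
      (∃ v : Fin 3 → ℂ, v ≠ 0 ∧ ∀ w : Fin 3 → ℂ, w ≠ 0 →
        ((eval w F = 0 ∧ eval w G = 0) ↔ ∃ c : ℂ, w = c • v)) ∧
      (∀ l m : ℂ, (l, m) ≠ (0, 0) → Irreducible (l • F + m • G)) ∧
      {p : Projectivization ℂ (Fin 2 → ℂ) |
        IsSingularMember F G (p.rep 0) (p.rep 1)}.Finite ∧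
      (∃ l m : ℂ, (l, m) ≠ (0, 0) ∧ IsSingularMember F G l m) := by
  obtain ⟨s, hs⟩ := IsAlgClosed.exists_pow_nat_eq (2 : ℂ) (n := 2) (by norm_num)
  exact ⟨trinodalQuartic s, osculatingQuartic s, isHomogeneous_trinodalQuartic s,
    isHomogeneous_osculatingQuartic s, linearIndependent_quartics hs,
    ⟨![1, 0, 0], fun h => by simpa using congrFun h 0, fun w _ => base_locus hs w⟩,
    fun _ _ hlm => irreducible_member hs hlm, finite_singular_members hs,
    1, 0, by simp, isSingularMember_trinodalQuartic hs⟩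
end

section
/- For every b ∈ ℂ with b ≠ 0, the ℂ-linear span R(b) in ℂ[t] of the set of products {u·v·w : u, v, w ∈ {t, t², t³ + b}} equals the ℂ-linear span of the nine polynomials t, t², t³, t⁴, t⁵, t⁶, t⁷, t⁸, t⁹ + b³. -/
open Polynomial

/-- For `b : ℂ`, the conic linear system `R₃(p)` on the twisted cubic, cut out by the cubic
cones with vertex `p = (b : 0 : 0 : −1)`: the ℂ-linear span of all products `u·v·w` with
`u, v, w ∈ {t, t², t³ + b}` inside `ℂ[t]`. -/
noncomputable def conicSystem (b : ℂ) : Submodule ℂ (Polynomial ℂ) :=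
  Submodule.span ℂ {p : Polynomial ℂ |
    ∃ u ∈ ({X, X ^ 2, X ^ 3 + C b} : Set (Polynomial ℂ)),
    ∃ v ∈ ({X, X ^ 2, X ^ 3 + C b} : Set (Polynomial ℂ)),
    ∃ w ∈ ({X, X ^ 2, X ^ 3 + C b} : Set (Polynomial ℂ)),
      p = u * v * w}

theorem C_mul_mem_submodule {R : Type*} [CommSemiring R] (S : Submodule R R[X]) (a : R)
    {p : R[X]} (hp : p ∈ S) : C a * p ∈ S := by
  rw [← smul_eq_C_mul]
  exact S.smul_mem a hp

theorem conicSystem_le {b : ℂ} {S : Submodule ℂ ℂ[X]}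
    (h₁ : X ∈ S) (h₂ : X ^ 2 ∈ S) (h₃ : X ^ 3 ∈ S) (h₄ : X ^ 4 ∈ S) (h₅ : X ^ 5 ∈ S)
    (h₆ : X ^ 6 ∈ S) (h₇ : X ^ 7 ∈ S) (h₈ : X ^ 8 ∈ S) (h₉ : X ^ 9 + C (b ^ 3) ∈ S) :
    conicSystem b ≤ S := by
  have key (a₁ a₂ a₃ a₄ a₅ a₆ a₇ a₈ a₉ : ℂ) :
      C a₁ * X + C a₂ * X ^ 2 + C a₃ * X ^ 3 + C a₄ * X ^ 4 + C a₅ * X ^ 5 + C a₆ * X ^ 6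
        + C a₇ * X ^ 7 + C a₈ * X ^ 8 + C a₉ * (X ^ 9 + C (b ^ 3)) ∈ S := by
    have smul (a : ℂ) {p : ℂ[X]} (hp : p ∈ S) : C a * p ∈ S := C_mul_mem_submodule S a hp
    exact add_mem (add_mem (add_mem (add_mem (add_mem (add_mem (add_mem (add_mem
      (smul a₁ h₁) (smul a₂ h₂)) (smul a₃ h₃)) (smul a₄ h₄)) (smul a₅ h₅)) (smul a₆ h₆))
      (smul a₇ h₇)) (smul a₈ h₈)) (smul a₉ h₉)
  have h₂₅ := key 0 b 0 0 1 0 0 0 0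
  have h₃₆ := key 0 0 b 0 0 1 0 0 0
  have h₄₇ := key 0 0 0 b 0 0 1 0 0
  have h₁₇ := key (b ^ 2) 0 0 (2 * b) 0 0 1 0 0
  have h₂₈ := key 0 (b ^ 2) 0 0 (2 * b) 0 0 1 0
  have h₃₉ := key 0 0 (3 * b ^ 2) 0 0 (3 * b) 0 0 1
  simp only [map_zero, map_one, map_mul, map_pow, map_ofNat] at h₂₅ h₃₆ h₄₇ h₁₇ h₂₈ h₃₉
  refine Submodule.span_le.2 ?_
  rintro _ ⟨_, rfl | rfl | rfl, _, rfl | rfl | rfl, _, rfl | rfl | rfl, rfl⟩ <;>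
  first
  | exact Set.mem_of_eq_of_mem (by ring1) h₃
  | exact Set.mem_of_eq_of_mem (by ring1) h₄
  | exact Set.mem_of_eq_of_mem (by ring1) h₅
  | exact Set.mem_of_eq_of_mem (by ring1) h₆
  | exact Set.mem_of_eq_of_mem (by ring1) h₂₅
  | exact Set.mem_of_eq_of_mem (by ring1) h₃₆
  | exact Set.mem_of_eq_of_mem (by ring1) h₄₇
  | exact Set.mem_of_eq_of_mem (by ring1) h₁₇
  | exact Set.mem_of_eq_of_mem (by ring1) h₂₈
  | exact Set.mem_of_eq_of_mem (by ring1) h₃₉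

theorem X_pow_mem_conicSystem {b : ℂ} (hb : b ≠ 0) :
    (X : ℂ[X]) ∈ conicSystem b ∧ X ^ 2 ∈ conicSystem b ∧ X ^ 3 ∈ conicSystem b ∧
      X ^ 4 ∈ conicSystem b ∧ X ^ 5 ∈ conicSystem b ∧ X ^ 6 ∈ conicSystem b ∧
      X ^ 7 ∈ conicSystem b ∧ X ^ 8 ∈ conicSystem b ∧ X ^ 9 + C (b ^ 3) ∈ conicSystem b := by
  have mem {u v w : ℂ[X]} (hu : u ∈ ({X, X ^ 2, X ^ 3 + C b} : Set ℂ[X]))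
      (hv : v ∈ ({X, X ^ 2, X ^ 3 + C b} : Set ℂ[X]))
      (hw : w ∈ ({X, X ^ 2, X ^ 3 + C b} : Set ℂ[X])) : u * v * w ∈ conicSystem b :=
    Submodule.subset_span ⟨u, hu, v, hv, w, hw, rfl⟩
  have hx : (X : ℂ[X]) ∈ ({X, X ^ 2, X ^ 3 + C b} : Set ℂ[X]) := by simp
  have hy : (X ^ 2 : ℂ[X]) ∈ ({X, X ^ 2, X ^ 3 + C b} : Set ℂ[X]) := by simp
  have hs : (X ^ 3 + C b : ℂ[X]) ∈ ({X, X ^ 2, X ^ 3 + C b} : Set ℂ[X]) := by simp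
  have smul (a : ℂ) {p : ℂ[X]} (hp : p ∈ conicSystem b) : C a * p ∈ conicSystem b :=
    C_mul_mem_submodule _ a hp
  have hC : (C b⁻¹ * C b : ℂ[X]) = 1 := by rw [← C_mul, inv_mul_cancel₀ hb, C_1]
  have h₃ : (X ^ 3 : ℂ[X]) ∈ conicSystem b := by
    convert mem hx hx hx using 1; ring
  have h₄ : (X ^ 4 : ℂ[X]) ∈ conicSystem b := by
    convert mem hx hx hy using 1; ring
  have h₅ : (X ^ 5 : ℂ[X]) ∈ conicSystem b := by
    convert mem hx hy hy using 1; ring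
  have h₆ : (X ^ 6 : ℂ[X]) ∈ conicSystem b := by
    convert mem hy hy hy using 1; ring
  have h₂ : (X ^ 2 : ℂ[X]) ∈ conicSystem b := by
    convert smul b⁻¹ (sub_mem (mem hx hx hs) h₅) using 1
    linear_combination (-X ^ 2) * hC
  have h₇ : (X ^ 7 : ℂ[X]) ∈ conicSystem b := by
    convert sub_mem (mem hy hy hs) (smul b h₄) using 1; ring
  have h₁ : (X : ℂ[X]) ∈ conicSystem b := by
    convert smul b⁻¹ (smul b⁻¹
      (sub_mem (sub_mem (mem hx hs hs) h₇) (smul b (add_mem h₄ h₄)))) using 1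
    linear_combination (-X * (C b⁻¹ * C b + 1)) * hC
  have h₈ : (X ^ 8 : ℂ[X]) ∈ conicSystem b := by
    convert sub_mem (sub_mem (mem hy hs hs) (smul b (add_mem h₅ h₅))) (smul b (smul b h₂)) using 1
    ring
  have h₉ : (X ^ 9 + C (b ^ 3) : ℂ[X]) ∈ conicSystem b := by
    convert sub_mem (sub_mem (mem hs hs hs) (smul (3 * b) h₆)) (smul (3 * b ^ 2) h₃) using 1
    simp only [map_mul, map_pow, map_ofNat]
    ring
  exact ⟨h₁, h₂, h₃, h₄, h₅, h₆, h₇, h₈, h₉⟩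

/-- For nonzero `b`, the conic linear system `R(b)` equals the span of
`t, t², …, t⁸, t⁹ + b³`. -/
theorem conicSystem_eq_span (b : ℂ) (hb : b ≠ 0) :
    conicSystem b =
      Submodule.span ℂ
        ({X, X ^ 2, X ^ 3, X ^ 4, X ^ 5, X ^ 6, X ^ 7, X ^ 8, X ^ 9 + C (b ^ 3)} :
          Set (Polynomial ℂ)) := by
  apply le_antisymm
  · apply conicSystem_le <;> refine Submodule.subset_span ?_ <;>
      simp only [Set.mem_insert_iff, Set.mem_singleton_iff, true_or, or_true]
  · obtain ⟨h₁, h₂, h₃, h₄, h₅, h₆, h₇, h₈, h₉⟩ := X_pow_mem_conicSystem hb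
    refine Submodule.span_le.2 ?_
    simp only [Set.insert_subset_iff, Set.singleton_subset_iff, SetLike.mem_coe]
    exact ⟨h₁, h₂, h₃, h₄, h₅, h₆, h₇, h₈, h₉⟩
end

section
/- For all nonzero b, b′ ∈ ℂ, the subspaces R(b) and R(b′) of ℂ[t] are equal if and only if b³ = b′³. -/
open Polynomial

theorem natDegree_le_and_coeff_zero_of_mem_generators {b : ℂ} {u : ℂ[X]}
    (hu : u ∈ ({X, X ^ 2, X ^ 3 + C b} : Set ℂ[X])) :
    u.natDegree ≤ 3 ∧ u.coeff 0 = b * u.coeff 3 := by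
  rcases hu with rfl | rfl | rfl
  · exact ⟨natDegree_X_le.trans (by norm_num), by simp [coeff_X]⟩
  · exact ⟨(natDegree_X_pow_le 2).trans (by norm_num), by simp [coeff_X_pow]⟩
  · exact ⟨by compute_degree, by simp [coeff_X_pow, coeff_C]⟩

theorem natDegree_le_and_coeff_zero_of_mem_conicSystem {b : ℂ} {p : ℂ[X]}
    (hp : p ∈ conicSystem b) :
    p.natDegree ≤ 9 ∧ p.coeff 0 = b ^ 3 * p.coeff 9 := by
  refine Submodule.span_induction ?_ (by simp) ?_ ?_ hp
  · rintro _ ⟨u, hu, v, hv, w, hw, rfl⟩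
    obtain ⟨du, cu⟩ := natDegree_le_and_coeff_zero_of_mem_generators hu
    obtain ⟨dv, cv⟩ := natDegree_le_and_coeff_zero_of_mem_generators hv
    obtain ⟨dw, cw⟩ := natDegree_le_and_coeff_zero_of_mem_generators hw
    have duv : (u * v).natDegree ≤ 6 := natDegree_mul_le_of_le du dv
    have huv : (u * v).coeff 6 = u.coeff 3 * v.coeff 3 := coeff_mul_add_eq_of_natDegree_le du dv
    have huvw : (u * v * w).coeff 9 = (u * v).coeff 6 * w.coeff 3 :=
      coeff_mul_add_eq_of_natDegree_le duv dw
    refine ⟨natDegree_mul_le_of_le duv dw, ?_⟩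
    rw [huvw, huv, mul_coeff_zero, mul_coeff_zero, cu, cv, cw]
    ring
  · rintro p q - - ⟨dp, cp⟩ ⟨dq, cq⟩
    refine ⟨natDegree_add_le_of_degree_le dp dq, ?_⟩
    rw [coeff_add, coeff_add, cp, cq, mul_add]
  · rintro a p - ⟨dp, cp⟩
    refine ⟨(natDegree_smul_le a p).trans dp, ?_⟩
    rw [coeff_smul, coeff_smul, cp, smul_eq_mul, smul_eq_mul, mul_left_comm]

theorem mul_mul_mem_conicSystem {b : ℂ} {u v w : ℂ[X]}
    (hu : u ∈ ({X, X ^ 2, X ^ 3 + C b} : Set ℂ[X]))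
    (hv : v ∈ ({X, X ^ 2, X ^ 3 + C b} : Set ℂ[X]))
    (hw : w ∈ ({X, X ^ 2, X ^ 3 + C b} : Set ℂ[X])) :
    u * v * w ∈ conicSystem b :=
  Submodule.subset_span ⟨u, hu, v, hv, w, hw, rfl⟩

theorem mem_conicSystem_of_C_mul_mem {b a : ℂ} (ha : a ≠ 0) {p : ℂ[X]}
    (h : C a * p ∈ conicSystem b) : p ∈ conicSystem b := by
  rw [← smul_eq_C_mul] at h
  exact (Submodule.smul_mem_iff _ ha).1 h

theorem C_mul_mem_conicSystem {b : ℂ} (a : ℂ) {p : ℂ[X]} (h : p ∈ conicSystem b) :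
    C a * p ∈ conicSystem b := by
  rw [← smul_eq_C_mul]
  exact Submodule.smul_mem _ a h

theorem mem_conicSystem_iff {b : ℂ} (hb : b ≠ 0) {p : ℂ[X]} :
    p ∈ conicSystem b ↔ p.natDegree ≤ 9 ∧ p.coeff 0 = b ^ 3 * p.coeff 9 := by
  refine ⟨natDegree_le_and_coeff_zero_of_mem_conicSystem, fun ⟨hd, hc⟩ => ?_⟩
  have m₁ : (X : ℂ[X]) ∈ ({X, X ^ 2, X ^ 3 + C b} : Set ℂ[X]) := by simp
  have m₂ : (X ^ 2 : ℂ[X]) ∈ ({X, X ^ 2, X ^ 3 + C b} : Set ℂ[X]) := by simp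
  have m₃ : (X ^ 3 + C b : ℂ[X]) ∈ ({X, X ^ 2, X ^ 3 + C b} : Set ℂ[X]) := by simp
  have h₃ : X ^ 3 ∈ conicSystem b := by
    convert mul_mul_mem_conicSystem m₁ m₁ m₁ using 1; ring
  have h₄ : X ^ 4 ∈ conicSystem b := by
    convert mul_mul_mem_conicSystem m₁ m₁ m₂ using 1; ring
  have h₅ : X ^ 5 ∈ conicSystem b := by
    convert mul_mul_mem_conicSystem m₁ m₂ m₂ using 1; ring
  have h₆ : X ^ 6 ∈ conicSystem b := by
    convert mul_mul_mem_conicSystem m₂ m₂ m₂ using 1; ring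
  have h₂ : X ^ 2 ∈ conicSystem b := by
    refine mem_conicSystem_of_C_mul_mem hb ?_
    convert sub_mem (mul_mul_mem_conicSystem m₁ m₁ m₃) h₅ using 1; ring
  have h₇ : X ^ 7 ∈ conicSystem b := by
    convert sub_mem (mul_mul_mem_conicSystem m₂ m₂ m₃) (C_mul_mem_conicSystem b h₄) using 1
    ring
  have h₁ : X ∈ conicSystem b := by
    refine mem_conicSystem_of_C_mul_mem (pow_ne_zero 2 hb) ?_
    convert sub_mem (sub_mem (mul_mul_mem_conicSystem m₁ m₃ m₃) h₇)
      (C_mul_mem_conicSystem (2 * b) h₄) using 1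
    simp only [map_mul, map_pow, map_ofNat]
    ring
  have h₈ : X ^ 8 ∈ conicSystem b := by
    convert sub_mem (sub_mem (mul_mul_mem_conicSystem m₂ m₃ m₃)
      (C_mul_mem_conicSystem (2 * b) h₅)) (C_mul_mem_conicSystem (b ^ 2) h₂) using 1
    simp only [map_mul, map_pow, map_ofNat]
    ring
  have h₉ : X ^ 9 + C (b ^ 3) ∈ conicSystem b := by
    convert sub_mem (sub_mem (mul_mul_mem_conicSystem m₃ m₃ m₃)
      (C_mul_mem_conicSystem (3 * b) h₆)) (C_mul_mem_conicSystem (3 * b ^ 2) h₃) using 1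
    simp only [map_mul, map_pow, map_ofNat]
    ring
  have key : p = C (p.coeff 1) * X + C (p.coeff 2) * X ^ 2 + C (p.coeff 3) * X ^ 3
      + C (p.coeff 4) * X ^ 4 + C (p.coeff 5) * X ^ 5 + C (p.coeff 6) * X ^ 6
      + C (p.coeff 7) * X ^ 7 + C (p.coeff 8) * X ^ 8
      + C (p.coeff 9) * (X ^ 9 + C (b ^ 3)) := by
    conv_lhs => rw [p.as_sum_range_C_mul_X_pow' (Nat.lt_succ_of_le hd)]
    simp only [Finset.sum_range_succ, Finset.sum_range_zero, hc, map_mul]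
    ring
  rw [key]
  have hC := @C_mul_mem_conicSystem b
  exact add_mem (add_mem (add_mem (add_mem (add_mem (add_mem (add_mem (add_mem
    (hC _ h₁) (hC _ h₂)) (hC _ h₃)) (hC _ h₄)) (hC _ h₅)) (hC _ h₆)) (hC _ h₇)) (hC _ h₈))
    (hC _ h₉)

/-- For nonzero `b, b′ ∈ ℂ`, the subspaces `R(b)` and `R(b′)` of `ℂ[t]` coincide if and
only if `b³ = b′³`. -/
theorem conicSystem_eq_iff (b b' : ℂ) (hb : b ≠ 0) (hb' : b' ≠ 0) :
    conicSystem b = conicSystem b' ↔ b ^ 3 = b' ^ 3 := by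
  constructor
  · intro h
    have hmem : X ^ 9 + C (b ^ 3) ∈ conicSystem b :=
      (mem_conicSystem_iff hb).2 ⟨by compute_degree, by simp [coeff_X_pow, coeff_C, -map_pow]⟩
    rw [h, mem_conicSystem_iff hb'] at hmem
    simpa [coeff_X_pow, coeff_C, -map_pow] using hmem.2
  · intro h
    ext p
    rw [mem_conicSystem_iff hb, mem_conicSystem_iff hb', h]
end

section
/- For every nonzero b ∈ ℂ, the ℂ-vector space R(b) ⊆ ℂ[t] has dimension 9. (This instantiates, for the twisted cubic d = 3 and a vertex p in the open set U of birational projection points, the paper's dimension count dim R_d(p) = C(d+2, 2) − 1.) -/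
open Polynomial

/-- The basis `t, …, t⁸, t⁹ + b³` of `conicSystem b` for `b ≠ 0`. -/
noncomputable def conicBasis (b : ℂ) (i : Fin 9) : Polynomial ℂ :=
  X ^ (i.val + 1) + C (if i = 8 then b ^ 3 else 0)

theorem linearIndependent_conicBasis (b : ℂ) : LinearIndependent ℂ (conicBasis b) := by
  rw [Fintype.linearIndependent_iff]
  intro g hg j
  have h := congrArg (fun p => coeff p (j.val + 1)) hg
  simpa [conicBasis, finsetSum_coeff, coeff_X_pow, coeff_C_succ, Fin.val_inj] using h

theorem conicSystem_le_span_conicBasis (b : ℂ) :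
    conicSystem b ≤ Submodule.span ℂ (Set.range (conicBasis b)) := by
  set S := Submodule.span ℂ (Set.range (conicBasis b))
  have hC : ∀ (a : ℂ) {p : Polynomial ℂ}, p ∈ S → C a * p ∈ S := fun a p hp => by
    rw [← smul_eq_C_mul]
    exact S.smul_mem a hp
  have hv (i : Fin 9) : conicBasis b i ∈ S := Submodule.subset_span ⟨i, rfl⟩
  have h1 : X ∈ S := by simpa [conicBasis] using hv 0
  have h2 : X ^ 2 ∈ S := by simpa [conicBasis] using hv 1
  have h3 : X ^ 3 ∈ S := by simpa [conicBasis] using hv 2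
  have h4 : X ^ 4 ∈ S := by simpa [conicBasis] using hv 3
  have h5 : X ^ 5 ∈ S := by simpa [conicBasis] using hv 4
  have h6 : X ^ 6 ∈ S := by simpa [conicBasis] using hv 5
  have h7 : X ^ 7 ∈ S := by simpa [conicBasis] using hv 6
  have h8 : X ^ 8 ∈ S := by simpa [conicBasis] using hv 7
  have h9 : X ^ 9 + C b ^ 3 ∈ S := by simpa [conicBasis] using hv 8
  have hxxz := S.add_mem h5 (hC b h2)
  have hxyz := S.add_mem h6 (hC b h3)
  have hyyz := S.add_mem h7 (hC b h4)
  have hxzz := S.add_mem h7 (S.add_mem (hC (2 * b) h4) (hC (b ^ 2) h1))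
  have hyzz := S.add_mem h8 (S.add_mem (hC (2 * b) h5) (hC (b ^ 2) h2))
  have hzzz := S.add_mem h9 (S.add_mem (hC (3 * b) h6) (hC (3 * b ^ 2) h3))
  have hC2 : (C 2 : Polynomial ℂ) = 2 := C_ofNat 2
  have hC3 : (C 3 : Polynomial ℂ) = 3 := C_ofNat 3
  simp only [C_mul, C_pow, hC2, hC3] at hxzz hyzz hzzz
  refine Submodule.span_le.mpr ?_
  rintro p ⟨u, hu, v, hv, w, hw, rfl⟩
  simp only [Set.mem_insert_iff, Set.mem_singleton_iff] at hu hv hw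
  rw [SetLike.mem_coe]
  rcases hu with rfl | rfl | rfl <;> rcases hv with rfl | rfl | rfl <;>
    rcases hw with rfl | rfl | rfl <;>
    first
    | (convert h3 using 1; ring1)
    | (convert h4 using 1; ring1)
    | (convert h5 using 1; ring1)
    | (convert h6 using 1; ring1)
    | (convert hxxz using 1; ring1)
    | (convert hxyz using 1; ring1)
    | (convert hyyz using 1; ring1)
    | (convert hxzz using 1; ring1)
    | (convert hyzz using 1; ring1)
    | (convert hzzz using 1; ring1)

theorem span_conicBasis_le_conicSystem {b : ℂ} (hb : b ≠ 0) :
    Submodule.span ℂ (Set.range (conicBasis b)) ≤ conicSystem b := by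
  set R := conicSystem b
  have hC : ∀ (a : ℂ) {p : Polynomial ℂ}, p ∈ R → C a * p ∈ R := fun a p hp => by
    rw [← smul_eq_C_mul]
    exact R.smul_mem a hp
  have hC' : ∀ {a : ℂ} {p : Polynomial ℂ}, a ≠ 0 → C a * p ∈ R → p ∈ R := fun ha hp => by
    rwa [← smul_eq_C_mul, R.smul_mem_iff ha] at hp
  have hmem {u v w : Polynomial ℂ} (hu : u ∈ ({X, X ^ 2, X ^ 3 + C b} : Set (Polynomial ℂ)))
      (hv : v ∈ ({X, X ^ 2, X ^ 3 + C b} : Set (Polynomial ℂ)))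
      (hw : w ∈ ({X, X ^ 2, X ^ 3 + C b} : Set (Polynomial ℂ))) : u * v * w ∈ R :=
    Submodule.subset_span ⟨u, hu, v, hv, w, hw, rfl⟩
  have hx : X ∈ ({X, X ^ 2, X ^ 3 + C b} : Set (Polynomial ℂ)) := by simp
  have hy : X ^ 2 ∈ ({X, X ^ 2, X ^ 3 + C b} : Set (Polynomial ℂ)) := by simp
  have hz : X ^ 3 + C b ∈ ({X, X ^ 2, X ^ 3 + C b} : Set (Polynomial ℂ)) := by simp
  have hC2 : (C 2 : Polynomial ℂ) = 2 := C_ofNat 2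
  have hC3 : (C 3 : Polynomial ℂ) = 3 := C_ofNat 3
  have h3 : X ^ 3 ∈ R := by convert hmem hx hx hx using 1; ring1
  have h4 : X ^ 4 ∈ R := by convert hmem hx hx hy using 1; ring1
  have h5 : X ^ 5 ∈ R := by convert hmem hx hy hy using 1; ring1
  have h6 : X ^ 6 ∈ R := by convert hmem hy hy hy using 1; ring1
  have h2 : X ^ 2 ∈ R := hC' hb <| by
    convert R.sub_mem (hmem hx hx hz) h5 using 1; ring1
  have h7 : X ^ 7 ∈ R := by
    convert R.sub_mem (hmem hy hy hz) (hC b h4) using 1; ring1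
  have h1 : X ∈ R := hC' (pow_ne_zero 2 hb) <| by
    convert R.sub_mem (R.sub_mem (hmem hx hz hz) h7) (hC (2 * b) h4) using 1
    simp only [C_mul, C_pow, hC2]; ring1
  have h8 : X ^ 8 ∈ R := by
    convert R.sub_mem (R.sub_mem (hmem hy hz hz) (hC (2 * b) h5)) (hC (b ^ 2) h2) using 1
    simp only [C_mul, C_pow, hC2]; ring1
  have h9 : X ^ 9 + C b ^ 3 ∈ R := by
    convert R.sub_mem (R.sub_mem (hmem hz hz hz) (hC (3 * b) h6)) (hC (3 * b ^ 2) h3) using 1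
    simp only [C_mul, C_pow, hC3]; ring1
  rw [Submodule.span_le]
  rintro _ ⟨i, rfl⟩
  rw [SetLike.mem_coe]
  fin_cases i
  · simpa [conicBasis] using h1
  · simpa [conicBasis] using h2
  · simpa [conicBasis] using h3
  · simpa [conicBasis] using h4
  · simpa [conicBasis] using h5
  · simpa [conicBasis] using h6
  · simpa [conicBasis] using h7
  · simpa [conicBasis] using h8
  · simpa [conicBasis] using h9

/-- For every nonzero `b ∈ ℂ`, the conic linear system `R(b)` has dimension `9` over `ℂ`
(the instance for `d = 3` of `dim R_d(p) = C(d+2,2) − 1`). -/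
theorem conicSystem_finrank (b : ℂ) (hb : b ≠ 0) :
    Module.finrank ℂ (conicSystem b) = 9 := by
  rw [(conicSystem_le_span_conicBasis b).antisymm (span_conicBasis_le_conicSystem hb),
    finrank_span_eq_card (linearIndependent_conicBasis b), Fintype.card_fin]
end
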